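/- Let T₀ ⊆ ℝ² be the reference triangle, the convex hull of (0,0), (1,0), (0,1). Let F = (F₁, F₂) : ℝ² → ℝ² have components that are bivariate polynomial functions of total degree at most 2, suppose F is injective on T₀, and suppose the Jacobian determinant J(ξ,η) is strictly positive on T₀. Let k ∈ ℕ and let a quadrature rule on T₀ with nodes (ξ_m, η_m) ∈ T₀ and strictly positive weights ω_m > 0, m = 1,…,M with M ≥ 1, be exact for all bivariate polynomials of total degree at most 2k + 2. If f is a bivariate polynomial function of total degree at most k and there exists ε > 0 with f(F(ξ_m, η_m)) ≥ ε for every node m, then the integral of f over the curved triangle is strictly positive: ∬_{F(T₀)} f dxdy > 0. -/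

import Mathlib

open MeasureTheory MvPolynomial

namespace MvPolynomial

variable {σ τ R : Type*} [CommSemiring R]

theorem totalDegree_pderiv_le (i : σ) (p : MvPolynomial σ R) :
    (pderiv i p).totalDegree ≤ p.totalDegree - 1 := by
  refine Finset.sup_le fun m hm => ?_
  have hsupp : m + Finsupp.single i 1 ∈ p.support := by
    rw [mem_support_iff] at hm ⊢
    exact fun h => hm (by rw [coeff_pderiv, h, zero_mul])
  have h := le_totalDegree hsupp
  rw [Finsupp.sum_add_index' (fun _ => rfl) (fun _ _ _ => rfl),
    Finsupp.sum_single_index rfl] at h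
  exact Nat.le_sub_of_add_le h

theorem totalDegree_bind₁_le (g : σ → MvPolynomial τ R) (p : MvPolynomial σ R) {d : ℕ}
    (hg : ∀ i, (g i).totalDegree ≤ d) :
    (bind₁ g p).totalDegree ≤ p.totalDegree * d := by
  rw [p.as_sum, map_sum, ← p.as_sum]
  refine totalDegree_finsetSum_le fun m hm => ?_
  rw [bind₁_monomial]
  calc (C (coeff m p) * ∏ i ∈ m.support, g i ^ m i).totalDegree
      ≤ ∑ i ∈ m.support, (g i ^ m i).totalDegree := by
        refine (totalDegree_mul _ _).trans ?_
        rw [totalDegree_C, zero_add]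
        exact totalDegree_finsetProd _ _
    _ ≤ ∑ i ∈ m.support, m i * d := Finset.sum_le_sum fun i _ =>
        (totalDegree_pow _ _).trans (Nat.mul_le_mul_left _ (hg i))
    _ = (m.sum fun _ e => e) * d := by rw [Finsupp.sum, Finset.sum_mul]
    _ ≤ p.totalDegree * d := Nat.mul_le_mul_right _ (le_totalDegree hm)

theorem hasFDerivAt_eval {ι 𝕜 : Type*} [Fintype ι] [NontriviallyNormedField 𝕜]
    (p : MvPolynomial ι 𝕜) (x : ι → 𝕜) :
    HasFDerivAt (fun y : ι → 𝕜 => eval y p)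
      (∑ i, eval x (pderiv i p) • ContinuousLinearMap.proj (R := 𝕜) (φ := fun _ : ι => 𝕜) i) x := by
  classical
  induction p using MvPolynomial.induction_on with
  | C a =>
    simp only [eval_C]
    refine (hasFDerivAt_const a x).congr_fderiv ?_
    ext v
    simp
  | add p q hp hq =>
    simp only [map_add]
    refine (hp.add hq).congr_fderiv ?_
    ext v
    simp [add_mul, Finset.sum_add_distrib]
  | mul_X p j hp =>
    have h := hp.mul (hasFDerivAt_apply (𝕜 := 𝕜) j x)
    simp only [map_mul, eval_X]
    refine h.congr_fderiv ?_
    ext v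
    simp [pderiv_X, Pi.single_apply, add_mul, Finset.sum_add_distrib, Finset.mul_sum, apply_ite,
      mul_assoc]

theorem hasFDerivAt_eval_pair (p : MvPolynomial (Fin 2) ℝ) (x : ℝ × ℝ) :
    HasFDerivAt (fun y : ℝ × ℝ => eval ![y.1, y.2] p)
      (eval ![x.1, x.2] (pderiv 0 p) • ContinuousLinearMap.fst ℝ ℝ ℝ +
        eval ![x.1, x.2] (pderiv 1 p) • ContinuousLinearMap.snd ℝ ℝ ℝ) x := by
  have hpair : HasFDerivAt (fun y : ℝ × ℝ => ![y.1, y.2])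
      (ContinuousLinearMap.pi ![ContinuousLinearMap.fst ℝ ℝ ℝ, ContinuousLinearMap.snd ℝ ℝ ℝ])
      x := by
    rw [hasFDerivAt_pi']
    intro i
    fin_cases i
    · exact hasFDerivAt_fst
    · exact hasFDerivAt_snd
  refine ((hasFDerivAt_eval p ![x.1, x.2]).comp x hpair).congr_fderiv ?_
  ext <;> simp [Fin.sum_univ_two]

end MvPolynomial

theorem ContinuousLinearMap.det_prod_fst_snd (a b c d : ℝ) :
    ((a • ContinuousLinearMap.fst ℝ ℝ ℝ + b • ContinuousLinearMap.snd ℝ ℝ ℝ).prod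
      (c • ContinuousLinearMap.fst ℝ ℝ ℝ + d • ContinuousLinearMap.snd ℝ ℝ ℝ)).det =
      a * d - b * c := by
  rw [ContinuousLinearMap.det, ← LinearMap.det_toMatrix (Module.Basis.finTwoProd ℝ),
    Matrix.det_fin_two]
  simp [LinearMap.toMatrix_apply]

/-- Positivity of the integral over a curved triangle: with a positive-weight
reference quadrature rule exact up to degree `2k + 2`, an injective quadratic
isoparametric map `F` with positive Jacobian on `T₀`, and a polynomial `f` of
total degree at most `k` satisfying `f(F(node m)) ≥ ε > 0` at every node,
the integral of `f` over `F(T₀)` is strictly positive. -/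
theorem curved_triangle_integral_positive
    (T₀ : Set (ℝ × ℝ))
    (hT₀ : T₀ = convexHull ℝ ({((0 : ℝ), (0 : ℝ)), (1, 0), (0, 1)} : Set (ℝ × ℝ)))
    (F₁ F₂ : MvPolynomial (Fin 2) ℝ)
    (hF₁ : F₁.totalDegree ≤ 2) (hF₂ : F₂.totalDegree ≤ 2)
    (F : (ℝ × ℝ) → (ℝ × ℝ))
    (hF : F = fun p => (eval ![p.1, p.2] F₁, eval ![p.1, p.2] F₂))
    (hFinj : Set.InjOn F T₀)
    (J : (ℝ × ℝ) → ℝ)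
    (hJ : J = fun p =>
      eval ![p.1, p.2] (pderiv 0 F₁ * pderiv 1 F₂ - pderiv 1 F₁ * pderiv 0 F₂))
    (hJpos : ∀ p ∈ T₀, 0 < J p)
    (k M : ℕ) (hM : 1 ≤ M)
    (node : Fin M → ℝ × ℝ) (hnode : ∀ m, node m ∈ T₀)
    (ω : Fin M → ℝ) (hω : ∀ m, 0 < ω m)
    (hexact : ∀ g : MvPolynomial (Fin 2) ℝ, g.totalDegree ≤ 2 * k + 2 →
      ∫ p in T₀, eval ![p.1, p.2] g = ∑ m, ω m * eval ![(node m).1, (node m).2] g)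
    (f : MvPolynomial (Fin 2) ℝ) (hf : f.totalDegree ≤ k)
    (ε : ℝ) (hε : 0 < ε)
    (hfpos : ∀ m, ε ≤ eval ![(F (node m)).1, (F (node m)).2] f) :
    0 < ∫ p in F '' T₀, eval ![p.1, p.2] f := by
  subst hT₀ hF hJ
  set T := convexHull ℝ ({((0 : ℝ), (0 : ℝ)), (1, 0), (0, 1)} : Set (ℝ × ℝ))
  have hTmeas : MeasurableSet T :=
    (Set.Finite.isClosed_convexHull ℝ (Set.toFinite _)).measurableSet
  set JP := pderiv 0 F₁ * pderiv 1 F₂ - pderiv 1 F₁ * pderiv 0 F₂ with hJP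
  have hdeg : (JP * bind₁ ![F₁, F₂] f).totalDegree ≤ 2 * k + 2 := by
    have h01 := totalDegree_pderiv_le 0 F₁
    have h11 := totalDegree_pderiv_le 1 F₁
    have h02 := totalDegree_pderiv_le 0 F₂
    have h12 := totalDegree_pderiv_le 1 F₂
    have hJdeg : JP.totalDegree ≤ 2 :=
      (totalDegree_sub _ _).trans <| max_le ((totalDegree_mul _ _).trans (by omega))
        ((totalDegree_mul _ _).trans (by omega))
    have hcomp : (bind₁ ![F₁, F₂] f).totalDegree ≤ f.totalDegree * 2 :=
      totalDegree_bind₁_le _ _ (Fin.forall_fin_two.mpr ⟨hF₁, hF₂⟩)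
    exact (totalDegree_mul _ _).trans (by omega)
  have heval (p : ℝ × ℝ) : eval ![p.1, p.2] (bind₁ ![F₁, F₂] f) =
      eval ![eval ![p.1, p.2] F₁, eval ![p.1, p.2] F₂] f := by
    rw [← aeval_eq_eval, ← aeval_eq_eval, aeval_bind₁]
    congr 2
    ext i
    fin_cases i <;> simp [aeval_eq_eval]
  rw [integral_image_eq_integral_abs_det_fderiv_smul volume hTmeas
    (fun x _ => ((hasFDerivAt_eval_pair F₁ x).prodMk
      (hasFDerivAt_eval_pair F₂ x)).hasFDerivWithinAt) hFinj]
  have hint : ∀ p ∈ T, |((eval ![p.1, p.2] (pderiv 0 F₁) • ContinuousLinearMap.fst ℝ ℝ ℝ +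
        eval ![p.1, p.2] (pderiv 1 F₁) • ContinuousLinearMap.snd ℝ ℝ ℝ).prod
      (eval ![p.1, p.2] (pderiv 0 F₂) • ContinuousLinearMap.fst ℝ ℝ ℝ +
        eval ![p.1, p.2] (pderiv 1 F₂) • ContinuousLinearMap.snd ℝ ℝ ℝ)).det| •
      eval ![eval ![p.1, p.2] F₁, eval ![p.1, p.2] F₂] f =
      eval ![p.1, p.2] (JP * bind₁ ![F₁, F₂] f) := by
    intro p hp
    have hpos := hJpos p hp
    have hdet : eval ![p.1, p.2] JP = eval ![p.1, p.2] (pderiv 0 F₁) *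
        eval ![p.1, p.2] (pderiv 1 F₂) - eval ![p.1, p.2] (pderiv 1 F₁) *
        eval ![p.1, p.2] (pderiv 0 F₂) := by simp [hJP]
    rw [ContinuousLinearMap.det_prod_fst_snd, ← hdet, abs_of_pos hpos, map_mul, heval, smul_eq_mul]
  rw [setIntegral_congr_fun hTmeas hint, hexact _ hdeg]
  have : Nonempty (Fin M) := ⟨⟨0, hM⟩⟩
  refine Finset.sum_pos (fun m _ => mul_pos (hω m) ?_) Finset.univ_nonempty
  rw [map_mul, heval]
  exact mul_pos (hJpos _ (hnode m)) (hε.trans_le (hfpos m))
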